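/- For every integer n ≥ 1, the abelian complexity of the 4-bonacci word q satisfies ρ_q(n) = 4 if and only if the normal Q-representation ⟨n⟩_Q is a prefix of the infinite periodic word 100010001000⋯ = (1000)^ω. -/

import Mathlib

/-- The m-bonacci substitution on letters. -/
def mbSub (m : ℕ) (ℓ : ℕ) : List ℕ :=
  if ℓ = m - 1 then [0] else [0, ℓ + 1]

/-- Application of the m-bonacci substitution to a word. -/
def mbApply (m : ℕ) (w : List ℕ) : List ℕ := w.flatMap (mbSub m)

/-- σ_m^k(0). -/
def mbIter (m k : ℕ) : List ℕ := (mbApply m)^[k] [0]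

/-- w is a factor of the m-bonacci word. -/
def mbFactor (m : ℕ) (w : List ℕ) : Prop := ∃ k, w <:+: mbIter m k

/-- The prefix of length n of the m-bonacci word. -/
def mbPrefix (m n : ℕ) : List ℕ := (mbIter m n).take n

/-- Abelian complexity: number of distinct Parikh vectors of factors of length n. -/
noncomputable def mbAC (m n : ℕ) : ℕ :=
  Set.ncard ((fun (w : List ℕ) (ℓ : ℕ) => w.count ℓ) ''
    {w : List ℕ | mbFactor m w ∧ w.length = n})

/-- Tribonacci numbers. -/
def tribN : ℕ → ℕ
  | 0 => 0
  | 1 => 0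
  | 2 => 1
  | n + 3 => tribN (n + 2) + tribN (n + 1) + tribN n

/-- Value of a digit string (most significant digit first) in the Tribonacci system. -/
def valT : List ℕ → ℕ
  | [] => 0
  | d :: rest => d * tribN (rest.length + 3) + valT rest

/-- L is the normal T-representation of n (MSB first, greedy). -/
def IsNormalTRep (n : ℕ) (L : List ℕ) : Prop :=
  (∀ d ∈ L, d ≤ 1) ∧ (∀ d ∈ L.take 1, d = 1) ∧ valT L = n ∧
    ∀ S, S <:+ L → valT S < tribN (S.length + 3)

/-- Value of a digit string (MSB first) in the m-bonacci numeration system U_j = |σ_m^j(0)|. -/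
def valU (m : ℕ) : List ℕ → ℕ
  | [] => 0
  | d :: rest => d * (mbIter m rest.length).length + valU m rest

/-- L is the normal U-representation of n (MSB first, greedy) in the m-bonacci system. -/
def IsNormalURep (m n : ℕ) (L : List ℕ) : Prop :=
  (∀ d ∈ L, d ≤ 1) ∧ (∀ d ∈ L.take 1, d = 1) ∧ valU m L = n ∧
    ∀ S, S <:+ L → valU m S < (mbIter m S.length).length

/-! ### The substitution and its iterates -/

@[simp] theorem mbApply_nil (m : ℕ) : mbApply m [] = [] := rfl

@[simp] theorem mbApply_cons (m x : ℕ) (w : List ℕ) :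
    mbApply m (x :: w) = mbSub m x ++ mbApply m w := rfl

@[simp] theorem mbApply_append (m : ℕ) (v w : List ℕ) :
    mbApply m (v ++ w) = mbApply m v ++ mbApply m w := List.flatMap_append

theorem mbSub_four_last : mbSub 4 3 = [0] := rfl

theorem mbSub_four_of_ne {x : ℕ} (hx : x ≠ 3) : mbSub 4 x = [0, x + 1] := if_neg hx

theorem mbIter_succ (m k : ℕ) : mbIter m (k + 1) = mbApply m (mbIter m k) :=
  Function.iterate_succ_apply' _ _ _

theorem mbIter_four_add_four (k : ℕ) :
    mbIter 4 (k + 4) = mbIter 4 (k + 3) ++ mbIter 4 (k + 2) ++ mbIter 4 (k + 1) ++ mbIter 4 k := by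
  induction k with
  | zero => decide
  | succ k ih =>
    have h := congrArg (mbApply 4) ih
    simpa only [mbApply_append, ← mbIter_succ] using h

theorem exists_mbIter_four_eq_zero_cons (k : ℕ) : ∃ t, mbIter 4 k = 0 :: t := by
  induction k with
  | zero => exact ⟨[], rfl⟩
  | succ k ih =>
    obtain ⟨t, ht⟩ := ih
    exact ⟨1 :: mbApply 4 t, by rw [mbIter_succ, ht]; rfl⟩

theorem mbIter_four_prefix_succ (k : ℕ) : mbIter 4 k <+: mbIter 4 (k + 1) := by
  induction k with
  | zero => exact ⟨[1], rfl⟩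
  | succ k ih =>
    obtain ⟨t, ht⟩ := ih
    exact ⟨mbApply 4 t, by rw [mbIter_succ 4 (k + 1), ← ht, mbApply_append, ← mbIter_succ, ht]⟩

theorem mbIter_four_prefix_add (k j : ℕ) : mbIter 4 k <+: mbIter 4 (k + j) := by
  induction j with
  | zero => exact List.prefix_rfl
  | succ j ih => exact ih.trans (mbIter_four_prefix_succ _)

theorem mbIter_four_length_lt_succ (k : ℕ) :
    (mbIter 4 k).length < (mbIter 4 (k + 1)).length := by
  match k with
  | 0 | 1 | 2 => decide
  | k + 3 =>
    obtain ⟨t, ht⟩ := exists_mbIter_four_eq_zero_cons k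
    rw [mbIter_four_add_four]
    simp only [List.length_append, ht, List.length_cons]
    omega

theorem mbIter_four_length_strictMono : StrictMono fun k => (mbIter 4 k).length :=
  strictMono_nat_of_lt_succ mbIter_four_length_lt_succ

theorem mbIter_four_append_zero_isPrefix (k : ℕ) :
    mbIter 4 (k + 3) ++ [0] <+: mbIter 4 (k + 4) := by
  obtain ⟨t, ht⟩ := exists_mbIter_four_eq_zero_cons (k + 2)
  exact ⟨t ++ mbIter 4 (k + 1) ++ mbIter 4 k, by rw [mbIter_four_add_four, ht]; simp⟩

/-! ### Counting letters in images -/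

theorem length_mbApply_four (v : List ℕ) :
    (mbApply 4 v).length + v.count 3 = 2 * v.length := by
  induction v with
  | nil => rfl
  | cons x v ih =>
    by_cases hx : x = 3
    · subst hx
      simp [mbSub_four_last]
      omega
    · simp [mbSub_four_of_ne hx, hx]
      omega

theorem count_zero_mbApply_four (v : List ℕ) : (mbApply 4 v).count 0 = v.length := by
  induction v with
  | nil => rfl
  | cons x v ih =>
    by_cases hx : x = 3
    · subst hx
      simp [mbSub_four_last, ih]
    · simp [mbSub_four_of_ne hx, ih]

theorem count_succ_mbApply_four {a : ℕ} (ha : a ≠ 3) (v : List ℕ) :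
    (mbApply 4 v).count (a + 1) = v.count a := by
  induction v with
  | nil => rfl
  | cons x v ih =>
    by_cases hx : x = 3
    · subst hx
      simp [mbSub_four_last, ih, ha.symm]
    · simp [mbSub_four_of_ne hx, ih, List.count_cons]

theorem count_four_mbApply_four (v : List ℕ) : (mbApply 4 v).count 4 = 0 := by
  induction v with
  | nil => rfl
  | cons x v ih =>
    by_cases hx : x = 3
    · subst hx
      simp [mbSub_four_last, ih]
    · simp [mbSub_four_of_ne hx, ih, hx]

/-! ### Factors of the 4-bonacci word -/

theorem mbFactor.mono {m : ℕ} {v w : List ℕ} (hw : mbFactor m w) (h : v <:+: w) :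
    mbFactor m v := by
  obtain ⟨k, hk⟩ := hw
  exact ⟨k, h.trans hk⟩

theorem mbFactor.mbApply {m : ℕ} {w : List ℕ} (hw : mbFactor m w) : mbFactor m (mbApply m w) := by
  obtain ⟨k, s, t, h⟩ := hw
  exact ⟨k + 1, _root_.mbApply m s, _root_.mbApply m t, by rw [mbIter_succ, ← h]; simp⟩

theorem mbFactor.lt_four {w : List ℕ} (hw : mbFactor 4 w) {x : ℕ} (hx : x ∈ w) : x < 4 := by
  obtain ⟨k, hk⟩ := hw
  replace hx := hk.subset hx
  clear hk
  induction k generalizing x with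
  | zero => simp [mbIter] at hx; omega
  | succ k ih =>
    rw [mbIter_succ, _root_.mbApply, List.mem_flatMap] at hx
    obtain ⟨y, hy, hxy⟩ := hx
    have := ih hy
    unfold mbSub at hxy
    split_ifs at hxy <;> simp at hxy <;> omega

theorem mbFactor.exists_concat {w : List ℕ} (hw : mbFactor 4 w) :
    ∃ y, mbFactor 4 (w ++ [y]) := by
  obtain ⟨k, hk⟩ := hw
  obtain ⟨s, t, h⟩ := hk.trans (mbIter_four_prefix_add k 3).isInfix
  have h0 : mbFactor 4 (s ++ w ++ t ++ [0]) :=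
    ⟨k + 4, h ▸ (mbIter_four_append_zero_isPrefix k).isInfix⟩
  cases t with
  | nil => exact ⟨0, h0.mono ⟨s, [], by simp⟩⟩
  | cons y t => exact ⟨y, h0.mono ⟨s, t ++ [0], by simp⟩⟩

theorem mbFactor.exists_append_length {w : List ℕ} (hw : mbFactor 4 w) (d : ℕ) :
    ∃ t, t.length = d ∧ mbFactor 4 (w ++ t) := by
  induction d with
  | zero => exact ⟨[], rfl, by simpa using hw⟩
  | succ d ih =>
    obtain ⟨t, ht, h⟩ := ih
    obtain ⟨y, hy⟩ := h.exists_concat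
    exact ⟨t ++ [y], by simp [ht], by simpa using hy⟩

theorem mbFactor.mbApply_concat_zero {w : List ℕ} (hw : mbFactor 4 w) :
    mbFactor 4 (_root_.mbApply 4 w ++ [0]) := by
  obtain ⟨y, hy⟩ := hw.exists_concat
  refine hy.mbApply.mono (List.IsPrefix.isInfix ?_)
  by_cases h : y = 3
  · simp [h, mbSub_four_last]
  · exact ⟨[y + 1], by simp [mbSub_four_of_ne h]⟩

theorem prefix_mbApply_four {V w : List ℕ} (h : w <+: mbApply 4 V) :
    ∃ v, v <+: V ∧ (w = mbApply 4 v ∨ w = mbApply 4 v ++ [0]) := by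
  induction V generalizing w with
  | nil => exact ⟨[], by simp, Or.inl (by simpa using h)⟩
  | cons y V ih =>
    rcases w with _ | ⟨x, w⟩
    · exact ⟨[], by simp, Or.inl rfl⟩
    by_cases hy : y = 3
    · subst hy
      simp only [mbApply_cons, mbSub_four_last, List.cons_append, List.nil_append,
        List.cons_prefix_cons] at h
      obtain ⟨rfl, h⟩ := h
      obtain ⟨v, hv, rfl | rfl⟩ := ih h
      · exact ⟨3 :: v, by simpa using hv, Or.inl rfl⟩
      · exact ⟨3 :: v, by simpa using hv, Or.inr rfl⟩
    · simp only [mbApply_cons, mbSub_four_of_ne hy, List.cons_append, List.nil_append,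
        List.cons_prefix_cons] at h
      obtain ⟨rfl, h⟩ := h
      rcases w with _ | ⟨z, w⟩
      · exact ⟨[], by simp, Or.inr rfl⟩
      rw [List.cons_prefix_cons] at h
      obtain ⟨rfl, h⟩ := h
      obtain ⟨v, hv, rfl | rfl⟩ := ih h
      · exact ⟨y :: v, by simpa using hv, Or.inl (by simp [mbSub_four_of_ne hy])⟩
      · exact ⟨y :: v, by simpa using hv, Or.inr (by simp [mbSub_four_of_ne hy])⟩

/-- Desubstitution of a factor: it is an image, possibly preceded by the last letter of a
two-letter block and possibly followed by the first letter of a block. -/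
theorem infix_mbApply_four {V w : List ℕ} (h : w <:+: mbApply 4 V) :
    (∃ v, v <:+: V ∧ (w = mbApply 4 v ∨ w = mbApply 4 v ++ [0])) ∨
    ∃ u v, u ≠ 3 ∧ u :: v <:+: V ∧
      (w = (u + 1) :: mbApply 4 v ∨ w = (u + 1) :: (mbApply 4 v ++ [0])) := by
  induction V generalizing w with
  | nil => exact Or.inl ⟨[], by simp, Or.inl (by simpa using h)⟩
  | cons y V ih =>
    have desubst_of_tail (h : w <:+: mbApply 4 V) :
        (∃ v, v <:+: y :: V ∧ (w = mbApply 4 v ∨ w = mbApply 4 v ++ [0])) ∨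
        ∃ u v, u ≠ 3 ∧ u :: v <:+: y :: V ∧
          (w = (u + 1) :: mbApply 4 v ∨ w = (u + 1) :: (mbApply 4 v ++ [0])) := by
      rcases ih h with ⟨v, hv, hw⟩ | ⟨u, v, hu, hv, hw⟩
      · exact Or.inl ⟨v, List.infix_cons hv, hw⟩
      · exact Or.inr ⟨u, v, hu, List.infix_cons hv, hw⟩
    have desubst_of_isPrefix (h : w <+: mbApply 4 (y :: V)) :
        ∃ v, v <:+: y :: V ∧ (w = mbApply 4 v ∨ w = mbApply 4 v ++ [0]) := by
      obtain ⟨v, hv, hw⟩ := prefix_mbApply_four h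
      exact ⟨v, hv.isInfix, hw⟩
    by_cases hy : y = 3
    · subst hy
      rw [mbApply_cons, mbSub_four_last, List.singleton_append, List.infix_cons_iff] at h
      exact h.elim (fun h => Or.inl (desubst_of_isPrefix h)) desubst_of_tail
    · rw [mbApply_cons, mbSub_four_of_ne hy, List.cons_append, List.singleton_append,
        List.infix_cons_iff, List.infix_cons_iff] at h
      rcases h with h | h | h
      · exact Or.inl (desubst_of_isPrefix (by simpa [mbSub_four_of_ne hy] using h))
      · rcases w with _ | ⟨x, w⟩
        · exact Or.inl ⟨[], by simp, Or.inl rfl⟩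
        rw [List.cons_prefix_cons] at h
        obtain ⟨rfl, h⟩ := h
        obtain ⟨v, hv, hw⟩ := prefix_mbApply_four h
        refine Or.inr ⟨y, v, hy, ?_, by simpa using hw⟩
        exact ((List.cons_prefix_cons).2 ⟨rfl, hv⟩).isInfix
      · exact desubst_of_tail h

/-! ### Left special words, and comparison of Parikh vectors with those of longer factors -/

/-- Every letter can precede `p` in the 4-bonacci word. -/
def LeftSpecial (p : List ℕ) : Prop := ∀ u < 4, mbFactor 4 (u :: p)

/-- Every factor one letter longer than `p` has at least as many occurrences of each letter. -/
def Dominated (p : List ℕ) : Prop :=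
  ∀ w, mbFactor 4 w → w.length = p.length + 1 → ∀ a, p.count a ≤ w.count a

/-- Some factor one letter longer than `p` has fewer occurrences of some letter, while every
letter count differs by at most one from that of `p`. -/
def HasDeficientFactor (p : List ℕ) : Prop :=
  ∃ w, mbFactor 4 w ∧ w.length = p.length + 1 ∧
    (∀ a, w.count a ≤ p.count a + 1 ∧ p.count a ≤ w.count a + 1) ∧ ∃ a, w.count a < p.count a

theorem LeftSpecial.mono {p v : List ℕ} (hv : LeftSpecial v) (h : p <+: v) :
    LeftSpecial p := fun u hu =>
  (hv u hu).mono ((List.cons_prefix_cons).2 ⟨rfl, h⟩).isInfix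

theorem LeftSpecial.nil : LeftSpecial [] := by
  intro u hu
  refine ⟨3, ?_⟩
  interval_cases u <;> decide

theorem leftSpecial_of_mbSub_append {p : List ℕ}
    (h : ∀ u < 4, mbFactor 4 (mbSub 4 u ++ p)) : LeftSpecial p := by
  intro u hu
  rcases u with _ | u
  · exact h 3 (by omega)
  · refine (h u (by omega)).mono ⟨[0], [], ?_⟩
    simp [mbSub_four_of_ne (show u ≠ 3 by omega)]

theorem LeftSpecial.mbApply {p : List ℕ} (hp : LeftSpecial p) : LeftSpecial (mbApply 4 p) :=
  leftSpecial_of_mbSub_append fun u hu => (hp u hu).mbApply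

theorem LeftSpecial.mbApply_concat_zero {p : List ℕ} (hp : LeftSpecial p) :
    LeftSpecial (_root_.mbApply 4 p ++ [0]) :=
  leftSpecial_of_mbSub_append fun u hu => by simpa using (hp u hu).mbApply_concat_zero

theorem leftSpecial_mbIter (k : ℕ) : LeftSpecial (mbIter 4 k) := by
  induction k with
  | zero => simpa [mbIter] using LeftSpecial.nil.mbApply_concat_zero
  | succ k ih => rw [mbIter_succ]; exact ih.mbApply

theorem Dominated.le_of_le_length {p v : List ℕ} (hp : Dominated p) (hv : mbFactor 4 v)
    (h : p.length + 1 ≤ v.length) (a : ℕ) : p.count a ≤ v.count a :=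
  (hp _ (hv.mono (List.take_prefix (p.length + 1) v).isInfix) (by simpa using h) a).trans
    ((List.take_sublist _ _).count_le a)

theorem Dominated.le_of_length_add {p v : List ℕ} (hp : Dominated p) (hv : mbFactor 4 v)
    {d : ℕ} (h : v.length + d = p.length + 1) (a : ℕ) : p.count a ≤ v.count a + d := by
  obtain ⟨t, ht, hvt⟩ := hv.exists_append_length d
  have h1 := hp _ hvt (by simp [ht, h]) a
  have h2 : t.count a ≤ t.length := List.count_le_length
  rw [List.count_append] at h1
  omega

theorem count_succ_cons_mbApply_four {a : ℕ} (ha : a ≠ 3) (u : ℕ) (v : List ℕ) :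
    ((u + 1) :: mbApply 4 v).count (a + 1) = (u :: v).count a := by
  simp [List.count_cons, count_succ_mbApply_four ha]

theorem Dominated.mbApply_concat_zero {p : List ℕ} (hp : Dominated p) :
    Dominated (mbApply 4 p ++ [0]) := by
  intro w hw hlen a
  obtain ⟨k, hk⟩ := hw
  replace hk := hk.trans (mbIter_four_prefix_succ k).isInfix
  rw [mbIter_succ] at hk
  have hlp := length_mbApply_four p
  simp only [List.length_append, List.length_singleton] at hlen
  suffices H : p.length + 1 ≤ w.count 0 ∧ ∀ b ≠ 3, p.count b ≤ w.count (b + 1) by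
    rcases a with _ | b
    · simpa [count_zero_mbApply_four] using H.1
    · by_cases hb : b = 3
      · subst hb
        simp [count_four_mbApply_four]
      · simpa [count_succ_mbApply_four hb] using H.2 b hb
  rcases infix_mbApply_four hk with ⟨v, hv, hwv⟩ | ⟨u, v, hu, huv, hwv⟩
  · have hv : mbFactor 4 v := ⟨k, hv⟩
    have hlv := length_mbApply_four v
    have hc0 := count_zero_mbApply_four v
    by_cases hn : p.length + 1 ≤ v.length
    · rcases hwv with rfl | rfl
      · exact ⟨by omega, fun b hb => by
          rw [count_succ_mbApply_four hb]; exact hp.le_of_le_length hv hn b⟩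
      · refine ⟨by simp; omega, fun b hb => ?_⟩
        simpa [count_succ_mbApply_four hb] using hp.le_of_le_length hv hn b
    · have h3 := hp.le_of_length_add hv (d := p.length + 1 - v.length) (by omega) 3
      rcases hwv with rfl | rfl
      · omega
      · simp only [List.length_append, List.length_singleton] at hlen
        have hl : v.length = p.length := by omega
        obtain ⟨y, hy⟩ := hv.exists_concat
        have hd := hp _ hy (by simp [hl])
        have hy3 : y = 3 := by
          by_contra hne
          have := hd 3
          simp [hne] at this
          omega
        subst hy3
        refine ⟨by simp; omega, fun b hb => ?_⟩
        simpa [count_succ_mbApply_four hb, List.count_cons, hb.symm] using hd b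
  · have huv : mbFactor 4 (u :: v) := ⟨k, huv⟩
    have hv : mbFactor 4 v := huv.mono (List.suffix_cons u v).isInfix
    have hlv := length_mbApply_four v
    have hc0 := count_zero_mbApply_four v
    by_cases hn : p.length + 1 ≤ v.length
    · have hle := hp.le_of_le_length hv hn
      rcases hwv with rfl | rfl
      · refine ⟨by simp; omega, fun b hb => ?_⟩
        rw [count_succ_cons_mbApply_four hb]
        exact (hle b).trans (List.count_le_count_cons ..)
      · refine ⟨by simp; omega, fun b hb => ?_⟩
        rw [← List.cons_append, List.count_append, count_succ_cons_mbApply_four hb]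
        exact (hle b).trans ((List.count_le_count_cons ..).trans (Nat.le_add_right _ _))
    · have h3 := hp.le_of_length_add huv (d := p.length - v.length) (by simp; omega) 3
      simp only [List.count_cons, beq_iff_eq, hu, if_false] at h3
      rcases hwv with rfl | rfl
      · simp only [List.length_cons] at hlen
        omega
      · simp only [List.length_cons, List.length_append, List.length_nil] at hlen
        have hl : v.length = p.length := by omega
        refine ⟨by simp; omega, fun b hb => ?_⟩
        rw [← List.cons_append, List.count_append, count_succ_cons_mbApply_four hb]
        exact (hp _ huv (by simp [hl]) b).trans (Nat.le_add_right _ _)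

theorem HasDeficientFactor.mbApply_concat_zero {p : List ℕ} (hp : HasDeficientFactor p) :
    HasDeficientFactor (mbApply 4 p ++ [0]) := by
  obtain ⟨v, hv, hlen, hd, a, ha⟩ := hp
  have hlp := length_mbApply_four p
  have hlv := length_mbApply_four v
  have hcv := count_zero_mbApply_four v
  have hcp := count_zero_mbApply_four p
  obtain ⟨w, hw, hwl, hw0, hws⟩ : ∃ w, mbFactor 4 w ∧ w.length = (mbApply 4 p).length + 2 ∧
      w.count 0 + p.count 3 = p.length + 1 + v.count 3 ∧
      ∀ b, w.count (b + 1) = (mbApply 4 v).count (b + 1) := by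
    have h3 := hd 3
    rcases lt_trichotomy (v.count 3) (p.count 3) with h | h | h
    · obtain ⟨t, ht⟩ : ∃ t, mbApply 4 v = 0 :: t := by
        rcases v with _ | ⟨y, v⟩
        · simp at hlen
        by_cases hy : y = 3
        · exact ⟨mbApply 4 v, by simp [hy, mbSub_four_last]⟩
        · exact ⟨(y + 1) :: mbApply 4 v, by simp [mbSub_four_of_ne hy]⟩
      have hσ := hv.mbApply
      rw [ht] at hσ hlv hcv ⊢
      simp only [List.length_cons, List.count_cons_self] at hlv hcv
      exact ⟨t, hσ.mono (List.suffix_cons 0 t).isInfix, by omega, by omega, by simp⟩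
    · exact ⟨mbApply 4 v, hv.mbApply, by omega, by omega, fun _ => rfl⟩
    · exact ⟨mbApply 4 v ++ [0], hv.mbApply_concat_zero, by simp; omega, by simp; omega, by simp⟩
  refine ⟨w, hw, by simpa using hwl, fun b => ?_, ?_⟩
  · rcases b with _ | b
    · have h3 := hd 3
      simp only [List.count_append, List.count_singleton_self, hcp]
      omega
    · by_cases hb : b = 3
      · subst hb
        simp [hws, count_four_mbApply_four]
      · simpa [hws, count_succ_mbApply_four hb] using hd b
  · by_cases hb : a = 3
    · subst hb
      exact ⟨0, by simp only [List.count_append, List.count_singleton_self, hcp]; omega⟩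
    · exact ⟨a + 1, by simpa [hws, count_succ_mbApply_four hb] using ha⟩

theorem LeftSpecial.hasDeficientFactor_mbApply_concat {p : List ℕ} (hp : LeftSpecial p) {x : ℕ}
    (hx : x ≠ 3) : HasDeficientFactor (_root_.mbApply 4 (p ++ [x])) := by
  obtain ⟨u, hu, hux⟩ : ∃ u < 2, u ≠ x := by
    by_cases h : x = 0
    · exact ⟨1, by omega, by omega⟩
    · exact ⟨0, by omega, by omega⟩
  have hw := (hp u (by omega)).mbApply_concat_zero
  have hu3 : u ≠ 3 := by omega
  refine ⟨_, hw, by simp [mbSub_four_of_ne hx, mbSub_four_of_ne hu3], fun b => ?_, x + 1, ?_⟩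
  · simp only [mbApply_append, mbApply_cons, mbApply_nil, mbSub_four_of_ne hx,
      mbSub_four_of_ne hu3, List.count_append, List.count_cons, List.count_nil, beq_iff_eq]
    split_ifs <;> omega
  · simp [mbSub_four_of_ne hx, mbSub_four_of_ne hu3, hux]

/-! ### Bispecial prefixes -/

/-- The bispecial prefixes of the 4-bonacci word, by increasing length. -/
def bispecialPrefix : ℕ → List ℕ
  | 0 => []
  | k + 1 => mbApply 4 (bispecialPrefix k) ++ [0]

theorem leftSpecial_bispecialPrefix (k : ℕ) : LeftSpecial (bispecialPrefix k) := by
  induction k with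
  | zero => exact LeftSpecial.nil
  | succ k ih => exact ih.mbApply_concat_zero

theorem dominated_bispecialPrefix (k : ℕ) : Dominated (bispecialPrefix k) := by
  induction k with
  | zero => intro w _ _ a; simp [bispecialPrefix]
  | succ k ih => exact ih.mbApply_concat_zero

theorem bispecialPrefix_succ_eq (k : ℕ) :
    bispecialPrefix (k + 1) = mbIter 4 k ++ bispecialPrefix k := by
  induction k with
  | zero => rfl
  | succ k ih =>
    change mbApply 4 (bispecialPrefix (k + 1)) ++ [0] =
      mbIter 4 (k + 1) ++ (mbApply 4 (bispecialPrefix k) ++ [0])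
    rw [ih, mbApply_append, ← mbIter_succ, List.append_assoc]

theorem bispecialPrefix_length_add_four (k : ℕ) :
    (bispecialPrefix (k + 4)).length =
      (mbIter 4 (k + 4)).length + (bispecialPrefix k).length := by
  simp only [bispecialPrefix_succ_eq, mbIter_four_add_four, List.length_append]
  omega

theorem eq_bispecialPrefix_or_hasDeficientFactor {p : List ℕ} {k : ℕ} (hp : p <+: mbIter 4 k) :
    (∃ j, p = bispecialPrefix j) ∨ HasDeficientFactor p := by
  induction k generalizing p with
  | zero =>
    rcases p with _ | ⟨x, p⟩
    · exact Or.inl ⟨0, rfl⟩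
    · have : x = 0 ∧ p = [] := by simpa [mbIter] using hp
      exact Or.inl ⟨1, by simp [bispecialPrefix, this]⟩
  | succ k ih =>
    rw [mbIter_succ] at hp
    have step {v : List ℕ} (hv : v <+: mbIter 4 k) :
        (∃ j, mbApply 4 v ++ [0] = bispecialPrefix j) ∨
          HasDeficientFactor (mbApply 4 v ++ [0]) := by
      rcases ih hv with ⟨j, rfl⟩ | h
      · exact Or.inl ⟨j + 1, rfl⟩
      · exact Or.inr h.mbApply_concat_zero
    obtain ⟨v, hv, rfl | rfl⟩ := prefix_mbApply_four hp
    · rcases List.eq_nil_or_concat v with rfl | ⟨p, x, rfl⟩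
      · exact Or.inl ⟨0, rfl⟩
      rw [List.concat_eq_append] at hv ⊢
      have hpk := (List.prefix_append p [x]).trans hv
      by_cases hx : x = 3
      · simpa [hx, mbSub_four_last] using step hpk
      · exact Or.inr (((leftSpecial_mbIter k).mono hpk).hasDeficientFactor_mbApply_concat hx)
    · exact step hv

/-! ### Abelian complexity -/

theorem length_eq_sum_count_of_lt_four {w : List ℕ} (hw : ∀ x ∈ w, x < 4) :
    w.length = w.count 0 + w.count 1 + w.count 2 + w.count 3 := by
  induction w with
  | nil => rfl
  | cons x w ih =>
    have h := ih fun y hy => hw y (List.mem_cons_of_mem _ hy)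
    have hx := hw x List.mem_cons_self
    interval_cases x <;> simp <;> omega

/-- The Parikh vectors of the words obtained by prepending a letter to `p`. -/
def leftExtensionParikh (p : List ℕ) : Set (ℕ → ℕ) :=
  (fun u ℓ => (u :: p).count ℓ) '' (Finset.range 4 : Set ℕ)

theorem ncard_leftExtensionParikh (p : List ℕ) : (leftExtensionParikh p).ncard = 4 := by
  rw [leftExtensionParikh, Set.ncard_image_of_injective, Set.ncard_coe_finset, Finset.card_range]
  intro u v h
  by_contra hne
  have := congrFun h u
  simp [Ne.symm hne] at this

theorem LeftSpecial.leftExtensionParikh_subset {p : List ℕ} (hp : LeftSpecial p) :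
    leftExtensionParikh p ⊆ (fun (w : List ℕ) (ℓ : ℕ) => w.count ℓ) ''
      {w : List ℕ | mbFactor 4 w ∧ w.length = p.length + 1} := by
  rintro _ ⟨u, hu, rfl⟩
  exact ⟨u :: p, ⟨hp u (by simpa using hu), rfl⟩, rfl⟩

theorem LeftSpecial.mbAC_eq_four {p : List ℕ} (hp : LeftSpecial p) (hd : Dominated p) :
    mbAC 4 (p.length + 1) = 4 := by
  refine Eq.trans (congrArg Set.ncard ?_) (ncard_leftExtensionParikh p)
  refine Set.Subset.antisymm ?_ hp.leftExtensionParikh_subset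
  rintro _ ⟨w, ⟨hw, hlen⟩, rfl⟩
  have hw4 : ∀ x ∈ w, x < 4 := fun x => hw.lt_four
  have hp4 : ∀ x ∈ p, x < 4 := fun x hx =>
    (hp 0 (by omega)).lt_four (List.mem_cons_of_mem _ hx)
  have hlw := length_eq_sum_count_of_lt_four hw4
  have hlp := length_eq_sum_count_of_lt_four hp4
  have hle := hd w hw hlen
  have h0 := hle 0
  have h1 := hle 1
  have h2 := hle 2
  have h3 := hle 3
  obtain ⟨u, hu, huw⟩ : ∃ u < 4, ∀ a < 4, w.count a = p.count a + if u = a then 1 else 0 := by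
    by_contra! hne
    obtain ⟨a, ha, hwa⟩ := hne 0 (by omega)
    obtain ⟨b, hb, hwb⟩ := hne 1 (by omega)
    obtain ⟨c, hc, hwc⟩ := hne 2 (by omega)
    obtain ⟨d, hd, hwd⟩ := hne 3 (by omega)
    interval_cases a <;> interval_cases b <;> interval_cases c <;> interval_cases d <;>
      simp at hwa hwb hwc hwd <;> omega
  refine ⟨u, by simpa using hu, funext fun a => ?_⟩
  by_cases ha : a < 4
  · simp [huw a ha, List.count_cons]
  · have hwa : w.count a = 0 := List.count_eq_zero.2 fun h => ha (hw4 a h)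
    have hpa : p.count a = 0 := List.count_eq_zero.2 fun h => ha (hp4 a h)
    simp [List.count_cons, hwa, hpa]
    omega

theorem LeftSpecial.mbAC_ne_four {p : List ℕ} (hp : LeftSpecial p) (hd : HasDeficientFactor p) :
    mbAC 4 (p.length + 1) ≠ 4 := by
  intro h
  obtain ⟨w, hw, hlen, -, a, ha⟩ := hd
  have heq := Set.eq_of_subset_of_ncard_le hp.leftExtensionParikh_subset
    (by rw [ncard_leftExtensionParikh]; exact h.le)
    (Set.finite_of_ncard_ne_zero (by rw [← mbAC, h]; decide))
  obtain ⟨u, -, hu⟩ : (fun ℓ => w.count ℓ) ∈ leftExtensionParikh p :=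
    heq ▸ ⟨w, ⟨hw, hlen⟩, rfl⟩
  have h1 : (u :: p).count a = w.count a := congrFun hu a
  have h2 : p.count a ≤ (u :: p).count a := List.count_le_count_cons ..
  omega

/-! ### Numeration -/

/-- The prefix of length `k` of the periodic word `(1000)^ω`. -/
def periodicPrefix : ℕ → List ℕ
  | 0 => []
  | 1 => [1]
  | 2 => [1, 0]
  | 3 => [1, 0, 0]
  | k + 4 => 1 :: 0 :: 0 :: 0 :: periodicPrefix k

@[simp] theorem length_periodicPrefix (k : ℕ) : (periodicPrefix k).length = k := by
  induction k using periodicPrefix.induct <;> simp_all [periodicPrefix]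

theorem valU_periodicPrefix_succ (k : ℕ) :
    valU 4 (periodicPrefix (k + 1)) = (bispecialPrefix k).length + 1 := by
  induction k using Nat.strong_induction_on with
  | _ k ih =>
    match k with
    | 0 | 1 | 2 | 3 => decide
    | k + 4 =>
      have := ih k (by omega)
      rw [bispecialPrefix_length_add_four]
      simp [periodicPrefix, valU, this, add_assoc]

theorem valU_periodicPrefix_lt (k : ℕ) :
    valU 4 (periodicPrefix k) < (mbIter 4 k).length := by
  induction k using periodicPrefix.induct with
  | case5 k ih =>
    simp only [periodicPrefix, valU, List.length_cons, length_periodicPrefix,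
      add_assoc, Nat.reduceAdd, mbIter_four_add_four, List.length_append]
    omega
  | _ => decide

theorem exists_prefix_flatten_replicate_iff (L : List ℕ) :
    (∃ k, L <+: (List.replicate k [1, 0, 0, 0]).flatten) ↔ ∃ k, L = periodicPrefix k := by
  constructor
  · rintro ⟨k, hk⟩
    induction k generalizing L with
    | zero => exact ⟨0, by simpa [periodicPrefix] using hk⟩
    | succ k ih =>
      rw [List.replicate_succ, List.flatten_cons] at hk
      rcases L with _ | ⟨a, _ | ⟨b, _ | ⟨c, _ | ⟨d, L⟩⟩⟩⟩
      · exact ⟨0, rfl⟩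
      · exact ⟨1, by simpa [periodicPrefix] using hk⟩
      · exact ⟨2, by simpa [periodicPrefix] using hk⟩
      · exact ⟨3, by simpa [periodicPrefix] using hk⟩
      · simp only [List.cons_append, List.nil_append, List.cons_prefix_cons] at hk
        obtain ⟨rfl, rfl, rfl, rfl, hk⟩ := hk
        obtain ⟨j, rfl⟩ := ih L hk
        exact ⟨j + 4, rfl⟩
  · rintro ⟨k, rfl⟩
    induction k using periodicPrefix.induct with
    | case5 k ih =>
      obtain ⟨j, hj⟩ := ih
      exact ⟨j + 1, by simpa [List.replicate_succ, periodicPrefix] using hj⟩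
    | _ => exact ⟨1, by decide⟩

theorem valU_suffix_periodicPrefix_lt {k : ℕ} {S : List ℕ} (hS : S <:+ periodicPrefix k) :
    valU 4 S < (mbIter 4 S.length).length := by
  induction k using periodicPrefix.induct with
  | case5 k ih =>
    have hlt := valU_periodicPrefix_lt (k + 4)
    have hk := valU_periodicPrefix_lt k
    have hle (j : ℕ) : (mbIter 4 k).length ≤ (mbIter 4 (k + j)).length :=
      (mbIter_four_prefix_add k j).length_le
    simp only [periodicPrefix, List.suffix_cons_iff] at hS
    rcases hS with rfl | rfl | rfl | rfl | hS
    · simpa [periodicPrefix] using hlt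
    · simpa [valU, add_assoc] using hk.trans_le (hle 3)
    · simpa [valU, add_assoc] using hk.trans_le (hle 2)
    · simpa [valU] using hk.trans_le (hle 1)
    · exact ih hS
  | _ =>
    simp only [periodicPrefix, List.suffix_cons_iff, List.suffix_nil] at hS
    rcases hS with rfl | rfl | rfl | rfl <;> decide

/-- Two greedy digit strings of the same length with the same value coincide. -/
theorem eq_of_valU_eq {m : ℕ} {L M : List ℕ} (hlen : L.length = M.length)
    (hL : ∀ S, S <:+ L → valU m S < (mbIter m S.length).length)
    (hM : ∀ S, S <:+ M → valU m S < (mbIter m S.length).length)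
    (h : valU m L = valU m M) : L = M := by
  induction L generalizing M with
  | nil => exact (List.length_eq_zero_iff.1 hlen.symm).symm
  | cons d L ih =>
    rcases M with _ | ⟨e, M⟩
    · simp at hlen
    have hlen' : L.length = M.length := by simpa using hlen
    have h1 := hL L (List.suffix_cons d L)
    have h2 := hM M (List.suffix_cons e M)
    simp only [valU, hlen'] at h h1
    have hpos : 0 < (mbIter m M.length).length := by omega
    have hde : d = e := by
      have := congrArg (· / (mbIter m M.length).length) h
      simpa [Nat.mul_comm _ (mbIter m M.length).length, Nat.mul_add_div hpos,
        Nat.div_eq_of_lt h1, Nat.div_eq_of_lt h2] using this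
    subst hde
    rw [ih hlen' (fun S hS => hL S (hS.trans (List.suffix_cons d L)))
      (fun S hS => hM S (hS.trans (List.suffix_cons d M))) (by omega)]

theorem IsNormalURep.mbIter_length_le {m n d : ℕ} {L : List ℕ} (h : IsNormalURep m n (d :: L)) :
    (mbIter m L.length).length ≤ n := by
  obtain ⟨-, h1, hv, -⟩ := h
  have hd : d = 1 := h1 d (by simp)
  rw [← hv, valU, hd]
  omega

theorem IsNormalURep.lt_mbIter_length {m n : ℕ} {L : List ℕ} (h : IsNormalURep m n L) :
    n < (mbIter m L.length).length :=
  h.2.2.1 ▸ h.2.2.2 L List.suffix_rfl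

theorem IsNormalURep.length_le {n : ℕ} {L M : List ℕ} (hL : IsNormalURep 4 n L)
    (hM : IsNormalURep 4 n M) : L.length ≤ M.length := by
  rcases L with _ | ⟨d, L⟩
  · simp
  · exact mbIter_four_length_strictMono.lt_iff_lt.1
      (hL.mbIter_length_le.trans_lt hM.lt_mbIter_length)

theorem IsNormalURep.unique {n : ℕ} {L M : List ℕ} (hL : IsNormalURep 4 n L)
    (hM : IsNormalURep 4 n M) : L = M :=
  eq_of_valU_eq ((hL.length_le hM).antisymm (hM.length_le hL)) hL.2.2.2 hM.2.2.2
    (hL.2.2.1.trans hM.2.2.1.symm)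

theorem isNormalURep_periodicPrefix (k : ℕ) :
    IsNormalURep 4 (valU 4 (periodicPrefix k)) (periodicPrefix k) := by
  refine ⟨?_, ?_, rfl, fun S => valU_suffix_periodicPrefix_lt⟩
  · induction k using periodicPrefix.induct <;> simp_all [periodicPrefix]
  · induction k using periodicPrefix.induct <;> simp [periodicPrefix]

theorem fourbonacci_abelian_complexity_eq_four_iff (n : ℕ) (hn : 1 ≤ n)
    (L : List ℕ) (hL : IsNormalURep 4 n L) :
    mbAC 4 n = 4 ↔ ∃ k, L <+: (List.replicate k [1, 0, 0, 0]).flatten := by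
  rw [exists_prefix_flatten_replicate_iff]
  constructor
  · intro h
    have hlen : ((mbIter 4 n).take (n - 1)).length + 1 = n := by
      have : n ≤ (mbIter 4 n).length := mbIter_four_length_strictMono.le_apply
      rw [List.length_take]
      omega
    have hp := List.take_prefix (n - 1) (mbIter 4 n)
    rcases eq_bispecialPrefix_or_hasDeficientFactor hp with ⟨j, hj⟩ | hd
    · refine ⟨j + 1, hL.unique ?_⟩
      rw [hj, ← valU_periodicPrefix_succ] at hlen
      exact hlen ▸ isNormalURep_periodicPrefix (j + 1)
    · exact absurd (by rwa [hlen]) (((leftSpecial_mbIter n).mono hp).mbAC_ne_four hd)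
  · rintro ⟨k, rfl⟩
    have hv := hL.2.2.1
    rcases k with _ | k
    · simp [periodicPrefix, valU] at hv
      omega
    · rw [← hv, valU_periodicPrefix_succ]
      exact (leftSpecial_bispecialPrefix k).mbAC_eq_four (dominated_bispecialPrefix k)
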